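/- Let ψ be the alternating bilinear map on the 2nd Schrödinger algebra sch_2 determined on basis pairs by ψ(x_1,x_2)=2e, ψ(y_1,y_2)=-2f, ψ(x_1,y_2)=-h, ψ(x_2,y_1)=h, ψ(x_1,z)=3x_2, ψ(y_1,z)=3y_2, ψ(x_2,z)=-3x_1, ψ(y_2,z)=-3y_1, and zero on all other pairs of basis vectors. Then ψ is a 2-cocycle of sch_2 with values in the adjoint module, ψ is not a 2-coboundary, and every adjoint 2-cocycle of sch_2 is the sum of a scalar multiple of ψ and a 2-coboundary; that is, the class of ψ is a basis of H²(sch_2, sch_2). -/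

import Mathlib

open scoped BigOperators

/-- Basis index set for the `n`-th Schrödinger algebra
`sch_n = span {h, e, f, x_1, …, x_n, y_1, …, y_n, z}`. -/
inductive SchIdx (n : ℕ) : Type
  | H : SchIdx n
  | E : SchIdx n
  | F : SchIdx n
  | X : Fin n → SchIdx n
  | Y : Fin n → SchIdx n
  | Z : SchIdx n
  deriving DecidableEq

/-- The underlying vector space of the `n`-th Schrödinger algebra. -/
abbrev Sch (n : ℕ) : Type := SchIdx n → ℂ

/-- The Lie bracket of `sch_n`, written componentwise with respect to the basis;
it encodes exactly the relations `[e,f]=h, [h,e]=2e, [h,f]=-2f, [x_i,y_i]=z,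
[h,x_i]=x_i, [h,y_i]=-y_i, [e,y_i]=x_i, [f,x_i]=y_i`. -/
noncomputable def br {n : ℕ} (u v : Sch n) : Sch n := fun j =>
  match j with
  | .H => u .E * v .F - u .F * v .E
  | .E => 2 * (u .H * v .E - u .E * v .H)
  | .F => -2 * (u .H * v .F - u .F * v .H)
  | .X i => (u .H * v (.X i) - u (.X i) * v .H) + (u .E * v (.Y i) - u (.Y i) * v .E)
  | .Y i => -(u .H * v (.Y i) - u (.Y i) * v .H) + (u .F * v (.X i) - u (.X i) * v .F)
  | .Z => ∑ i : Fin n, (u (.X i) * v (.Y i) - u (.Y i) * v (.X i))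

/-- The bracket of `sch_n` as a bilinear map. -/
noncomputable def brL (n : ℕ) : Sch n →ₗ[ℂ] Sch n →ₗ[ℂ] Sch n :=
  LinearMap.mk₂ ℂ br
    (by
      intro m m' v; funext j; cases j <;> simp only [br, Pi.add_apply]
      case Z => rw [← Finset.sum_add_distrib]; exact Finset.sum_congr rfl fun i _ => by ring
      all_goals ring)
    (by
      intro c m v; funext j; cases j <;> simp only [br, Pi.smul_apply, smul_eq_mul]
      case Z => rw [Finset.mul_sum]; exact Finset.sum_congr rfl fun i _ => by ring
      all_goals ring)
    (by
      intro m v v'; funext j; cases j <;> simp only [br, Pi.add_apply]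
      case Z => rw [← Finset.sum_add_distrib]; exact Finset.sum_congr rfl fun i _ => by ring
      all_goals ring)
    (by
      intro c m v; funext j; cases j <;> simp only [br, Pi.smul_apply, smul_eq_mul]
      case Z => rw [Finset.mul_sum]; exact Finset.sum_congr rfl fun i _ => by ring
      all_goals ring)

/-- The basis vector `h`. -/
noncomputable def hV (n : ℕ) : Sch n := Pi.single SchIdx.H 1
/-- The basis vector `e`. -/
noncomputable def eV (n : ℕ) : Sch n := Pi.single SchIdx.E 1
/-- The basis vector `f`. -/
noncomputable def fV (n : ℕ) : Sch n := Pi.single SchIdx.F 1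
/-- The central basis vector `z`. -/
noncomputable def zV (n : ℕ) : Sch n := Pi.single SchIdx.Z 1
/-- The basis vector `x_i`. -/
noncomputable def xV {n : ℕ} (i : Fin n) : Sch n := Pi.single (SchIdx.X i) 1
/-- The basis vector `y_i`. -/
noncomputable def yV {n : ℕ} (i : Fin n) : Sch n := Pi.single (SchIdx.Y i) 1

/-- The subalgebra `sl_2 = span {e, f, h}` of `sch_n`. -/
noncomputable def sl2 (n : ℕ) : Submodule ℂ (Sch n) :=
  Submodule.span ℂ {eV n, fV n, hV n}
/-- The alternating bilinear map `ψ` on `sch_2` determined on basis pairs by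
`ψ(x_1,x_2) = 2e`, `ψ(y_1,y_2) = -2f`, `ψ(x_1,y_2) = -h`, `ψ(x_2,y_1) = h`,
`ψ(x_1,z) = 3x_2`, `ψ(y_1,z) = 3y_2`, `ψ(x_2,z) = -3x_1`, `ψ(y_2,z) = -3y_1`,
and zero on all other pairs of basis vectors. -/
noncomputable def psiSch2 : Sch 2 →ₗ[ℂ] Sch 2 →ₗ[ℂ] Sch 2 :=
  LinearMap.mk₂ ℂ
    (fun a b j =>
      match j with
      | .E => 2 * (a (.X 0) * b (.X 1) - a (.X 1) * b (.X 0))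
      | .F => -2 * (a (.Y 0) * b (.Y 1) - a (.Y 1) * b (.Y 0))
      | .H => -(a (.X 0) * b (.Y 1) - a (.Y 1) * b (.X 0)) +
          (a (.X 1) * b (.Y 0) - a (.Y 0) * b (.X 1))
      | .X i => if i = 0 then -3 * (a (.X 1) * b .Z - a .Z * b (.X 1))
          else 3 * (a (.X 0) * b .Z - a .Z * b (.X 0))
      | .Y i => if i = 0 then -3 * (a (.Y 1) * b .Z - a .Z * b (.Y 1))
          else 3 * (a (.Y 0) * b .Z - a .Z * b (.Y 0))
      | .Z => 0)
    (by
      intro m m' v; funext j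
      cases j <;> simp only [Pi.add_apply] <;> try ring
      all_goals (rename_i i; by_cases h : i = 0 <;> simp only [h, if_true, if_false,
        reduceIte] <;> ring)
    )
    (by
      intro c m v; funext j
      cases j <;> simp only [Pi.smul_apply, smul_eq_mul] <;> try ring
      all_goals (rename_i i; by_cases h : i = 0 <;> simp only [h, if_true, if_false,
        reduceIte] <;> ring)
    )
    (by
      intro m v v'; funext j
      cases j <;> simp only [Pi.add_apply] <;> try ring
      all_goals (rename_i i; by_cases h : i = 0 <;> simp only [h, if_true, if_false,
        reduceIte] <;> ring)
    )
    (by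
      intro c m v; funext j
      cases j <;> simp only [Pi.smul_apply, smul_eq_mul] <;> try ring
      all_goals (rename_i i; by_cases h : i = 0 <;> simp only [h, if_true, if_false,
        reduceIte] <;> ring)
    )

instance : Fintype (SchIdx 2) where
  elems := {.H, .E, .F, .X 0, .X 1, .Y 0, .Y 1, .Z}
  complete := by
    intro k
    cases k with
    | X i => fin_cases i <;> simp
    | Y i => fin_cases i <;> simp
    | _ => simp

theorem sum_schIdx {M : Type*} [AddCommMonoid M] (g : SchIdx 2 → M) :
    ∑ k, g k = g .H + (g .E + (g .F + (g (.X 0) + (g (.X 1) + (g (.Y 0) +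
      (g (.Y 1) + g .Z)))))) := by
  change ∑ k ∈ ({.H, .E, .F, .X 0, .X 1, .Y 0, .Y 1, .Z} : Finset (SchIdx 2)), g k = _
  simp

/-- The standard basis vector of `sch_2` with index `k`. -/
noncomputable abbrev bv (k : SchIdx 2) : Sch 2 := Pi.single k 1

theorem sum_smul_bv (u : Sch 2) : ∑ k, u k • bv k = u := by
  ext j
  simp [Finset.sum_apply, Pi.single_apply]

theorem map_eq_sum (ω : Sch 2 →ₗ[ℂ] Sch 2) (u : Sch 2) (j : SchIdx 2) :
    ω u j = ∑ k, u k * ω (bv k) j := by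
  conv_lhs => rw [← sum_smul_bv u]
  simp [Finset.sum_apply]

@[simp] theorem brL_apply (u v : Sch 2) : brL 2 u v = br u v := rfl

theorem br_self (u : Sch 2) : br u u = 0 := by
  funext j
  cases j <;> simp only [br, Fin.sum_univ_two, Pi.zero_apply] <;> ring

theorem br_jacobi (u v w : Sch 2) : br u (br v w) + br v (br w u) + br w (br u v) = 0 := by
  funext j
  cases j <;> simp only [br, Fin.sum_univ_two, Pi.add_apply, Pi.zero_apply] <;> ring

/-- Alternating 2-cocycles of `sch_2` with values in the adjoint module. -/
structure IsCocycle (φ : Sch 2 →ₗ[ℂ] Sch 2 →ₗ[ℂ] Sch 2) : Prop where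
  alt : ∀ a, φ a a = 0
  cocycle : ∀ a b c, brL 2 a (φ b c) + brL 2 b (φ c a) + brL 2 c (φ a b) +
    φ a (brL 2 b c) + φ b (brL 2 c a) + φ c (brL 2 a b) = 0

/-- The coboundary of a linear endomorphism of `sch_2`. -/
noncomputable def cobd (ω : Sch 2 →ₗ[ℂ] Sch 2) : Sch 2 →ₗ[ℂ] Sch 2 →ₗ[ℂ] Sch 2 :=
  (brL 2).comp ω + (brL 2).compl₂ ω - (brL 2).compr₂ ω

theorem cobd_apply (ω : Sch 2 →ₗ[ℂ] Sch 2) (a b : Sch 2) :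
    cobd ω a b = brL 2 (ω a) b + brL 2 a (ω b) - ω (brL 2 a b) := rfl

theorem swap_of_alt {φ : Sch 2 →ₗ[ℂ] Sch 2 →ₗ[ℂ] Sch 2} (h : ∀ a, φ a a = 0)
    (a b : Sch 2) : φ a b = -φ b a := by
  have := h (a + b)
  simp only [map_add, LinearMap.add_apply, h, zero_add, add_zero] at this
  exact eq_neg_of_add_eq_zero_right this

theorem brL_swap (a b : Sch 2) : brL 2 a b = -brL 2 b a :=
  swap_of_alt br_self a b

theorem isCocycle_cobd (ω : Sch 2 →ₗ[ℂ] Sch 2) : IsCocycle (cobd ω) where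
  alt a := by
    rw [cobd_apply, brL_swap a (ω a), brL_apply a a, br_self]
    simp
  cocycle a b c := by
    have h (u v w : Sch 2) :
        brL 2 u (brL 2 v w) + brL 2 v (brL 2 w u) + brL 2 w (brL 2 u v) = 0 :=
      br_jacobi u v w
    have h₁ := h (ω a) b c
    have h₂ := h a (ω b) c
    have h₃ := h a b (ω c)
    have h₄ := congrArg ω (h a b c)
    simp only [map_add, map_zero] at h₄
    simp only [cobd_apply, map_add, map_sub]
    rw [brL_swap a (ω (brL 2 b c)), brL_swap b (ω (brL 2 c a)), brL_swap c (ω (brL 2 a b))]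
    linear_combination h₁ + h₂ + h₃ - h₄

theorem IsCocycle.sub {φ χ : Sch 2 →ₗ[ℂ] Sch 2 →ₗ[ℂ] Sch 2} (hφ : IsCocycle φ)
    (hχ : IsCocycle χ) : IsCocycle (φ - χ) where
  alt a := by simp [hφ.alt, hχ.alt]
  cocycle a b c := by
    have h₁ := hφ.cocycle a b c
    have h₂ := hχ.cocycle a b c
    simp only [LinearMap.sub_apply, map_sub]
    linear_combination h₁ - h₂

/-- The eigenvalue of `ad h` on a basis vector. -/
def wt : SchIdx 2 → ℂ
  | .H => 0
  | .E => 2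
  | .F => -2
  | .X _ => 1
  | .Y _ => -1
  | .Z => 0

theorem br_h (u : Sch 2) (j : SchIdx 2) : br (bv .H) u j = wt j * u j := by
  cases j <;> simp [br, wt]

theorem br_h_bv (k : SchIdx 2) : br (bv .H) (bv k) = wt k • bv k := by
  ext j
  rw [br_h]
  by_cases h : j = k <;> simp [h]

theorem wt_mul_cocycle {φ : Sch 2 →ₗ[ℂ] Sch 2 →ₗ[ℂ] Sch 2} (hφ : IsCocycle φ)
    (a b j : SchIdx 2) :
    (wt j - wt a - wt b) * φ (bv a) (bv b) j = cobd (φ (bv .H)) (bv a) (bv b) j := by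
  have h := congrFun (hφ.cocycle (bv .H) (bv a) (bv b)) j
  rw [swap_of_alt hφ.alt (bv b) (bv .H), brL_swap (bv b) (bv .H),
    brL_swap (bv b) (φ (bv .H) (bv a))] at h
  simp only [brL_apply, br_h_bv, map_neg, map_smul, Pi.add_apply, Pi.neg_apply, Pi.smul_apply,
    br_h, swap_of_alt hφ.alt (bv b) (bv a), smul_eq_mul, Pi.zero_apply] at h
  simp only [cobd_apply, brL_apply, Pi.add_apply, Pi.sub_apply]
  simp only [← brL_apply] at h ⊢
  linear_combination h

theorem br_scale_left (g : ℂ → ℂ) (u : Sch 2) (b j : SchIdx 2) :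
    br (fun k => g (wt k) * u k) (bv b) j = g (wt j - wt b) * br u (bv b) j := by
  cases b <;> cases j <;> simp [br, wt, Pi.single_apply] <;> norm_num <;> ring

theorem br_scale_right (g : ℂ → ℂ) (u : Sch 2) (b j : SchIdx 2) :
    br (bv b) (fun k => g (wt k) * u k) j = g (wt j - wt b) * br (bv b) u j := by
  simp only [← brL_apply, brL_swap (bv b), Pi.neg_apply]
  rw [brL_apply, brL_apply, br_scale_left, mul_neg]

theorem wt_of_br_ne_zero {a b k : SchIdx 2} (h : br (bv a) (bv b) k ≠ 0) :
    wt k = wt a + wt b := by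
  contrapose! h
  revert h
  cases a <;> cases b <;> cases k <;> simp [br, wt, Pi.single_apply] <;> norm_num

/-- The endomorphism whose coboundary removes the components of nonzero weight from `φ`. -/
noncomputable def wtPrimitive (φ : Sch 2 →ₗ[ℂ] Sch 2 →ₗ[ℂ] Sch 2) : Sch 2 →ₗ[ℂ] Sch 2 :=
  ∑ a, (LinearMap.proj a).smulRight (fun j => (wt j - wt a)⁻¹ * φ (bv .H) (bv a) j)

theorem wtPrimitive_bv (φ : Sch 2 →ₗ[ℂ] Sch 2 →ₗ[ℂ] Sch 2) (a : SchIdx 2) :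
    wtPrimitive φ (bv a) = fun j => (wt j - wt a)⁻¹ * φ (bv .H) (bv a) j := by
  ext j
  simp [wtPrimitive, Finset.sum_apply, Pi.single_apply, ite_apply]

theorem cobd_wtPrimitive (φ : Sch 2 →ₗ[ℂ] Sch 2 →ₗ[ℂ] Sch 2) (a b j : SchIdx 2) :
    cobd (wtPrimitive φ) (bv a) (bv b) j =
      (wt j - wt a - wt b)⁻¹ * cobd (φ (bv .H)) (bv a) (bv b) j := by
  have h₁ := br_scale_left (fun x => (x - wt a)⁻¹) (φ (bv .H) (bv a)) b j
  have h₂ := br_scale_right (fun x => (x - wt b)⁻¹) (φ (bv .H) (bv b)) a j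
  have h₃ : wtPrimitive φ (br (bv a) (bv b)) j =
      (wt j - wt a - wt b)⁻¹ * φ (bv .H) (br (bv a) (bv b)) j := by
    rw [map_eq_sum, map_eq_sum (φ (bv .H)), Finset.mul_sum]
    refine Finset.sum_congr rfl fun k _ => ?_
    by_cases hk : br (bv a) (bv b) k = 0
    · simp [hk]
    · rw [wtPrimitive_bv, wt_of_br_ne_zero hk, sub_sub]
      ring
  rw [cobd_apply, cobd_apply]
  simp only [brL_apply, Pi.add_apply, Pi.sub_apply, h₃, wtPrimitive_bv, h₁, h₂]
  rw [sub_right_comm (wt j) (wt b)]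
  ring

theorem wt_zero_part {φ : Sch 2 →ₗ[ℂ] Sch 2 →ₗ[ℂ] Sch 2} (hφ : IsCocycle φ)
    {a b j : SchIdx 2} (h : wt j ≠ wt a + wt b) :
    (φ - cobd (wtPrimitive φ)) (bv a) (bv b) j = 0 := by
  have h' : wt j - wt a - wt b ≠ 0 := by
    rwa [sub_sub, sub_ne_zero]
  simp only [LinearMap.sub_apply, Pi.sub_apply]
  rw [cobd_wtPrimitive, ← wt_mul_cocycle hφ, inv_mul_cancel_left₀ h', sub_self]

theorem isCocycle_psiSch2 : IsCocycle psiSch2 where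
  alt a := by
    funext j
    cases j <;> simp [psiSch2, mul_comm]
  cocycle a b c := by
    funext j
    cases j with
    | X i => fin_cases i <;> simp [psiSch2, br, Fin.sum_univ_two] <;> ring
    | Y i => fin_cases i <;> simp [psiSch2, br, Fin.sum_univ_two] <;> ring
    | _ =>
      simp [psiSch2, br, Fin.sum_univ_two]
      ring

theorem psiSch2_ne_cobd (ω : Sch 2 →ₗ[ℂ] Sch 2) : psiSch2 ≠ cobd ω := by
  intro h
  have h₁ : br (bv (.X 0)) (bv (.X 1)) = 0 := by
    funext j
    cases j <;> simp [br]
  have h₂ := congrFun (LinearMap.congr_fun₂ h (bv (.X 0)) (bv (.X 1))) .E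
  simp [psiSch2, cobd_apply, h₁] at h₂
  simp [br] at h₂

/-- The position of the type of a basis vector in the list `h, e, f, x, y, z`. -/
def rank : SchIdx 2 → ℕ
  | .H => 0
  | .E => 1
  | .F => 2
  | .X _ => 3
  | .Y _ => 4
  | .Z => 5

theorem ext_of_alt {φ χ : Sch 2 →ₗ[ℂ] Sch 2 →ₗ[ℂ] Sch 2} (hφ : ∀ a, φ a a = 0)
    (hχ : ∀ a, χ a a = 0)
    (h : ∀ a b j, rank a ≤ rank b → φ (bv a) (bv b) j = χ (bv a) (bv b) j) : φ = χ := by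
  have key (a b : SchIdx 2) : φ (bv a) (bv b) = χ (bv a) (bv b) := by
    rcases le_total (rank a) (rank b) with hab | hab
    · exact funext fun j => h a b j hab
    · rw [swap_of_alt hφ, swap_of_alt hχ, funext fun j => h b a j hab]
  refine (Pi.basisFun ℂ (SchIdx 2)).ext fun a => (Pi.basisFun ℂ (SchIdx 2)).ext fun b => ?_
  simpa using key a b

theorem cocycle_coord {φ : Sch 2 →ₗ[ℂ] Sch 2 →ₗ[ℂ] Sch 2} (hφ : IsCocycle φ)
    (a b c j : SchIdx 2) :
    br (bv a) (φ (bv b) (bv c)) j - br (bv b) (φ (bv a) (bv c)) j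
      + br (bv c) (φ (bv a) (bv b)) j + ∑ k, br (bv b) (bv c) k * φ (bv a) (bv k) j
      - ∑ k, br (bv a) (bv c) k * φ (bv b) (bv k) j
      + ∑ k, br (bv a) (bv b) k * φ (bv c) (bv k) j = 0 := by
  have h := congrFun (hφ.cocycle (bv a) (bv b) (bv c)) j
  rw [swap_of_alt hφ.alt (bv c) (bv a), brL_swap (bv c) (bv a)] at h
  simp only [map_neg, Pi.add_apply, Pi.neg_apply, brL_apply, Pi.zero_apply] at h
  rw [map_eq_sum (φ (bv a)), map_eq_sum (φ (bv b)), map_eq_sum (φ (bv c))] at h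
  linear_combination h

/-- Cocycles all of whose components preserve the `ad h`-weight. -/
structure IsWtCocycle (φ : Sch 2 →ₗ[ℂ] Sch 2 →ₗ[ℂ] Sch 2) : Prop extends IsCocycle φ where
  wt_zero : ∀ {a b j : SchIdx 2}, wt j ≠ wt a + wt b → φ (bv a) (bv b) j = 0

section relations

variable {φ : Sch 2 →ₗ[ℂ] Sch 2 →ₗ[ℂ] Sch 2}

theorem hf_f (hφ : IsWtCocycle φ) : φ (bv .H) (bv .F) .F = -φ (bv .H) (bv .E) .E := by
  have h := cocycle_coord hφ.toIsCocycle .H .E .F .H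
  simp [sum_schIdx, br, hφ.alt, swap_of_alt hφ.alt (bv .F) (bv .E)] at h
  linear_combination -h

theorem hz_h (hφ : IsWtCocycle φ) : φ (bv .H) (bv .Z) .H = 0 := by
  have h := cocycle_coord hφ.toIsCocycle .H .E .Z .E
  simp [sum_schIdx, br, swap_of_alt hφ.alt (bv .Z) (bv .E)] at h
  exact h

theorem hz_z (hφ : IsWtCocycle φ) : φ (bv .H) (bv .Z) .Z = 0 := by
  have h := cocycle_coord hφ.toIsCocycle .E .F .Z .Z
  simp [sum_schIdx, br, swap_of_alt hφ.alt (bv .Z) (bv .H)] at h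
  linear_combination h

theorem fz_f (hφ : IsWtCocycle φ) : φ (bv .F) (bv .Z) .F = -φ (bv .E) (bv .Z) .E := by
  have h := cocycle_coord hφ.toIsCocycle .E .F .Z .H
  simp [sum_schIdx, br, swap_of_alt hφ.alt (bv .Z) (bv .H), hz_h hφ] at h
  linear_combination h

theorem hx_x_add (hφ : IsWtCocycle φ) (i j : Fin 2) :
    φ (bv .F) (bv (.X i)) (.Y j) + φ (bv .E) (bv (.Y i)) (.X j) =
      (if i = j then φ (bv .E) (bv .F) .H else 0) + φ (bv .H) (bv (.X i)) (.X j) := by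
  have h := cocycle_coord hφ.toIsCocycle .E .F (.X i) (.X j)
  fin_cases i <;> fin_cases j <;>
    simp [sum_schIdx, br, swap_of_alt hφ.alt (bv (.X _)) (bv .H)] at h ⊢ <;>
    linear_combination h

theorem hy_y_add (hφ : IsWtCocycle φ) (i j : Fin 2) :
    φ (bv .F) (bv (.X i)) (.Y j) + φ (bv .E) (bv (.Y i)) (.X j) =
      (if i = j then φ (bv .E) (bv .F) .H else 0) - φ (bv .H) (bv (.Y i)) (.Y j) := by
  have h := cocycle_coord hφ.toIsCocycle .E .F (.Y i) (.Y j)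
  fin_cases i <;> fin_cases j <;>
    simp [sum_schIdx, br, swap_of_alt hφ.alt (bv (.Y _)) (bv .H)] at h ⊢ <;>
    linear_combination -h

theorem hx_x (hφ : IsWtCocycle φ) (i j : Fin 2) :
    φ (bv .H) (bv (.X i)) (.X j) = if i = j then φ (bv .H) (bv .E) .E / 2 else 0 := by
  have h := cocycle_coord hφ.toIsCocycle .H .E (.Y i) (.X j)
  have h₁ := hx_x_add hφ i j
  have h₂ := hy_y_add hφ i j
  fin_cases i <;> fin_cases j <;>
    simp [sum_schIdx, br, swap_of_alt hφ.alt (bv (.Y _)) (bv .E)] at h h₁ h₂ ⊢ <;>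
    linear_combination (h - h₁ + h₂) / 2

theorem hy_y (hφ : IsWtCocycle φ) (i j : Fin 2) :
    φ (bv .H) (bv (.Y i)) (.Y j) = if i = j then -φ (bv .H) (bv .E) .E / 2 else 0 := by
  have h₁ := hx_x_add hφ i j
  have h₂ := hy_y_add hφ i j
  have h₃ := hx_x hφ i j
  split_ifs at * <;> linear_combination h₂ - h₁ - h₃

theorem xy_h_of_e (hφ : IsWtCocycle φ) (i j : Fin 2) :
    2 * φ (bv (.X i)) (bv (.Y j)) .H =
      (if i = j then φ (bv .E) (bv .Z) .E else 0) - φ (bv (.X i)) (bv (.X j)) .E := by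
  have h := cocycle_coord hφ.toIsCocycle .E (.X i) (.Y j) .E
  fin_cases i <;> fin_cases j <;> simp [sum_schIdx, br] at h ⊢ <;> linear_combination -h

theorem xy_h_of_f (hφ : IsWtCocycle φ) (i j : Fin 2) :
    2 * φ (bv (.X i)) (bv (.Y j)) .H =
      (if i = j then φ (bv .E) (bv .Z) .E else 0) + φ (bv (.Y i)) (bv (.Y j)) .F := by
  have h := cocycle_coord hφ.toIsCocycle .F (.X i) (.Y j) .F
  fin_cases i <;> fin_cases j <;>
    simp [sum_schIdx, br, hφ.alt, fz_f hφ, swap_of_alt hφ.alt (bv (.Y 1)) (bv (.Y 0))] at h ⊢ <;>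
    linear_combination h

theorem yz_y (hφ : IsWtCocycle φ) (i j : Fin 2) :
    φ (bv (.Y i)) (bv .Z) (.Y j) =
      φ (bv (.X i)) (bv .Z) (.X j) - if i = j then φ (bv .E) (bv .Z) .E else 0 := by
  have h := cocycle_coord hφ.toIsCocycle .E (.Y i) .Z (.X j)
  fin_cases i <;> fin_cases j <;>
    simp [sum_schIdx, br, swap_of_alt hφ.alt (bv .Z) (bv (.X _))] at h ⊢ <;>
    linear_combination h

theorem xy_z_swap (hφ : IsWtCocycle φ) (i j : Fin 2) :
    φ (bv (.X i)) (bv (.Y j)) .Z - φ (bv .F) (bv (.X i)) (.Y j) =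
      φ (bv (.X j)) (bv (.Y i)) .Z - φ (bv .F) (bv (.X j)) (.Y i) := by
  have h := cocycle_coord hφ.toIsCocycle .F (.X 0) (.X 1) .Z
  simp [sum_schIdx, br] at h
  fin_cases i <;> fin_cases j
  · rfl
  · exact sub_eq_sub_iff_add_eq_add.2 (by simp; linear_combination -h)
  · exact sub_eq_sub_iff_add_eq_add.2 (by simp; linear_combination h)
  · rfl

theorem x_zero_z_x_zero (hφ : IsWtCocycle φ) :
    φ (bv (.X 0)) (bv .Z) (.X 0) = φ (bv .E) (bv .Z) .E / 2 := by
  have h := cocycle_coord hφ.toIsCocycle (.X 0) (.X 1) (.Y 1) (.X 0)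
  have h₁ := xy_h_of_e hφ 1 1
  simp [sum_schIdx, br, hφ.alt] at h h₁
  linear_combination h + h₁ / 2

theorem x_one_z_x_one (hφ : IsWtCocycle φ) :
    φ (bv (.X 1)) (bv .Z) (.X 1) = φ (bv .E) (bv .Z) .E / 2 := by
  have h := cocycle_coord hφ.toIsCocycle (.X 0) (.X 1) (.Y 0) (.X 1)
  have h₁ := xy_h_of_e hφ 0 0
  simp [sum_schIdx, br, hφ.alt] at h h₁
  linear_combination -h + h₁ / 2

theorem x_zero_z_x_one (hφ : IsWtCocycle φ) :
    φ (bv (.X 0)) (bv .Z) (.X 1) = 3 / 2 * φ (bv (.X 0)) (bv (.X 1)) .E := by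
  have h := cocycle_coord hφ.toIsCocycle (.X 0) (.X 1) (.Y 1) (.X 1)
  have h₁ := xy_h_of_e hφ 0 1
  simp [sum_schIdx, br, hφ.alt] at h h₁
  linear_combination h - h₁ / 2

theorem x_one_z_x_zero (hφ : IsWtCocycle φ) :
    φ (bv (.X 1)) (bv .Z) (.X 0) = -(3 / 2) * φ (bv (.X 0)) (bv (.X 1)) .E := by
  have h := cocycle_coord hφ.toIsCocycle (.X 0) (.X 1) (.Y 0) (.X 0)
  have h₁ := xy_h_of_e hφ 1 0
  simp [sum_schIdx, br, hφ.alt, swap_of_alt hφ.alt (bv (.X 1)) (bv (.X 0))] at h h₁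
  linear_combination -h - h₁ / 2

/-- The endomorphism of weight zero whose coboundary agrees with `φ` up to a multiple of
`psiSch2`, for a cocycle `φ` of weight zero. -/
noncomputable def wtZeroPrimitive (φ : Sch 2 →ₗ[ℂ] Sch 2 →ₗ[ℂ] Sch 2) : Sch 2 →ₗ[ℂ] Sch 2 :=
  ∑ a, (LinearMap.proj a).smulRight (match a with
    | .H => (φ (bv .H) (bv .E) .E / 2) • bv .H - φ (bv .E) (bv .F) .Z • bv .Z
    | .E => (φ (bv .E) (bv .F) .H + φ (bv .H) (bv .E) .E / 2) • bv .E
    | .F => 0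
    | .X i => ∑ j, ((φ (bv (.X i)) (bv (.Y j)) .Z + φ (bv .F) (bv (.X i)) (.Y j)) / 2) • bv (.X j)
    | .Y i => ∑ j, ((φ (bv (.X i)) (bv (.Y j)) .Z - φ (bv .F) (bv (.X i)) (.Y j)) / 2) • bv (.Y j)
    | .Z => -(φ (bv .E) (bv .Z) .E / 2) • bv .H)

theorem wtZeroPrimitive_bv (φ : Sch 2 →ₗ[ℂ] Sch 2 →ₗ[ℂ] Sch 2) (a : SchIdx 2) :
    wtZeroPrimitive φ (bv a) = match a with
    | .H => (φ (bv .H) (bv .E) .E / 2) • bv .H - φ (bv .E) (bv .F) .Z • bv .Z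
    | .E => (φ (bv .E) (bv .F) .H + φ (bv .H) (bv .E) .E / 2) • bv .E
    | .F => 0
    | .X i => ∑ j, ((φ (bv (.X i)) (bv (.Y j)) .Z + φ (bv .F) (bv (.X i)) (.Y j)) / 2) • bv (.X j)
    | .Y i => ∑ j, ((φ (bv (.X i)) (bv (.Y j)) .Z - φ (bv .F) (bv (.X i)) (.Y j)) / 2) • bv (.Y j)
    | .Z => -(φ (bv .E) (bv .Z) .E / 2) • bv .H := by
  simp [wtZeroPrimitive, Pi.single_apply]

set_option maxHeartbeats 800000 in
/-- The components of a cocycle of weight zero modulo a multiple of `psiSch2`. -/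
theorem wt_zero_apply (hφ : IsWtCocycle φ) (a b j : SchIdx 2) (hab : rank a ≤ rank b) :
    φ (bv a) (bv b) j =
      ((φ (bv (.X 0)) (bv (.X 1)) .E / 2) • psiSch2 + cobd (wtZeroPrimitive φ)) (bv a) (bv b) j := by
  simp only [LinearMap.add_apply, LinearMap.smul_apply, Pi.add_apply, Pi.smul_apply, cobd_apply,
    Pi.sub_apply]
  rw [map_eq_sum (wtZeroPrimitive φ), sum_schIdx]
  simp only [wtZeroPrimitive_bv]
  by_cases hw : wt j = wt a + wt b
  · cases a <;> cases b <;> cases j <;>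
      first
      | (refine absurd hab ?_; simp [rank]; done)
      | (refine absurd hw ?_; norm_num [wt]; done)
      | simp [psiSch2, br, hφ.alt]
    case pos.H.E.E => ring
    case pos.H.F.F => exact hf_f hφ
    case pos.H.X.X i j =>
      have h := hx_x hφ i j
      fin_cases i <;> fin_cases j <;> simp at h ⊢ <;> linear_combination h
    case pos.H.Y.Y i j =>
      have h := hy_y hφ i j
      fin_cases i <;> fin_cases j <;> simp at h ⊢ <;> linear_combination h
    case pos.H.Z.H => exact hz_h hφ
    case pos.H.Z.Z => exact hz_z hφ
    case pos.E.Y.X i j =>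
      have h := hx_x_add hφ i j
      have h₁ := hx_x hφ i j
      fin_cases i <;> fin_cases j <;> simp at h h₁ ⊢ <;> linear_combination h + h₁
    case pos.E.Z.E => ring
    case pos.F.X.Y i j => fin_cases i <;> fin_cases j <;> simp <;> ring
    case pos.F.Z.F => linear_combination fz_f hφ
    case pos.X.X.E i j =>
      have h := swap_of_alt hφ.alt (bv (.X 1)) (bv (.X 0))
      fin_cases i <;> fin_cases j <;> simp [hφ.alt, h]
    case pos.X.Y.H i j =>
      have h := xy_h_of_e hφ i j
      have h₁ := swap_of_alt hφ.alt (bv (.X 1)) (bv (.X 0))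
      fin_cases i <;> fin_cases j <;> simp [hφ.alt, h₁] at h ⊢ <;> linear_combination h / 2
    case pos.X.Y.Z i j =>
      have h := xy_z_swap hφ i j
      fin_cases i <;> fin_cases j <;> simp at h ⊢ <;> linear_combination h / 2
    case pos.X.Z.X i j =>
      fin_cases i <;> fin_cases j <;>
        simp [x_zero_z_x_zero hφ, x_one_z_x_one hφ, x_zero_z_x_one hφ, x_one_z_x_zero hφ] <;> ring
    case pos.Y.Y.F i j =>
      have h := xy_h_of_e hφ i j
      have h₁ := xy_h_of_f hφ i j
      have h₂ := swap_of_alt hφ.alt (bv (.X 1)) (bv (.X 0))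
      fin_cases i <;> fin_cases j <;> simp [hφ.alt, h₂] at h h₁ ⊢ <;> linear_combination h - h₁
    case pos.Y.Z.Y i j =>
      have h := yz_y hφ i j
      fin_cases i <;> fin_cases j <;>
        simp [x_zero_z_x_zero hφ, x_one_z_x_one hφ, x_zero_z_x_one hφ,
          x_one_z_x_zero hφ] at h ⊢ <;>
        linear_combination h
  · rw [hφ.wt_zero hw]
    cases a <;> cases b <;> cases j <;>
      first
      | (refine absurd ?_ hw; norm_num [wt]; done)
      | simp [psiSch2, br]

theorem wt_zero_eq (hφ : IsWtCocycle φ) :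
    φ = (φ (bv (.X 0)) (bv (.X 1)) .E / 2) • psiSch2 + cobd (wtZeroPrimitive φ) :=
  ext_of_alt hφ.alt (fun a => by simp [isCocycle_psiSch2.alt, (isCocycle_cobd _).alt])
    (wt_zero_apply hφ)

end relations

/-- **`ψ` is an adjoint 2-cocycle of `sch_2`, it is not a 2-coboundary, and every adjoint
2-cocycle of `sch_2` is a scalar multiple of `ψ` plus a 2-coboundary; that is, the class
of `ψ` is a basis of `H²(sch_2, sch_2)`.** -/
theorem psiSch2_basis_of_H2 :
    (∀ a, psiSch2 a a = 0) ∧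
    (∀ a b c, brL 2 a (psiSch2 b c) + brL 2 b (psiSch2 c a) + brL 2 c (psiSch2 a b) +
      psiSch2 a (brL 2 b c) + psiSch2 b (brL 2 c a) + psiSch2 c (brL 2 a b) = 0) ∧
    (¬ ∃ ω : Sch 2 →ₗ[ℂ] Sch 2, ∀ a b,
      psiSch2 a b = brL 2 (ω a) b + brL 2 a (ω b) - ω (brL 2 a b)) ∧
    (∀ φ : Sch 2 →ₗ[ℂ] Sch 2 →ₗ[ℂ] Sch 2,
      (∀ a, φ a a = 0) →
      (∀ a b c, brL 2 a (φ b c) + brL 2 b (φ c a) + brL 2 c (φ a b) +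
        φ a (brL 2 b c) + φ b (brL 2 c a) + φ c (brL 2 a b) = 0) →
      ∃ (t : ℂ) (ω : Sch 2 →ₗ[ℂ] Sch 2), ∀ a b,
        φ a b = t • psiSch2 a b +
          (brL 2 (ω a) b + brL 2 a (ω b) - ω (brL 2 a b))) := by
  refine ⟨isCocycle_psiSch2.alt, isCocycle_psiSch2.cocycle, ?_, fun φ halt hcoc => ?_⟩
  · rintro ⟨ω, hω⟩
    exact psiSch2_ne_cobd ω (LinearMap.ext₂ hω)
  · have hφ : IsCocycle φ := ⟨halt, hcoc⟩
    have hχ : IsWtCocycle (φ - cobd (wtPrimitive φ)) :=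
      { hφ.sub (isCocycle_cobd _) with wt_zero := wt_zero_part hφ }
    refine ⟨(φ - cobd (wtPrimitive φ)) (bv (.X 0)) (bv (.X 1)) .E / 2,
      wtZeroPrimitive (φ - cobd (wtPrimitive φ)) + wtPrimitive φ, fun a b => ?_⟩
    have h := LinearMap.congr_fun₂ (wt_zero_eq hχ) a b
    rw [LinearMap.sub_apply, LinearMap.sub_apply, sub_eq_iff_eq_add] at h
    rw [h]
    simp only [LinearMap.add_apply, LinearMap.smul_apply, cobd_apply, map_add]
    abel
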